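/- (Uniqueness) Let (M,N) and (M',N') be full-rank matrix pairs in M_r(𝓕)² that are pair-equivalent, with inv(M) = inv(M') = μ. Let N* be a μ-generic matrix with (D_μ, N*) pair-equivalent to (M,N), and N** a μ-generic matrix with (D_μ, N**) pair-equivalent to (M',N'). Then the right fillings {k_ij} and {k'_ij} computed from N* and N** via the determinantal formula are equal: k_ij = k'_ij for all 1 ≤ i ≤ j ≤ r. -/

import Mathlib

open Matrix HahnSeries

noncomputable section

variable {K : Type*} [Field K] [CharZero K]

/-- Membership in the valuation ring `R = {a ∈ 𝓕 : a = 0 ∨ ‖a‖ ≥ 0}` of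
`𝓕 = HahnSeries ℝ K`. -/
def inR (a : HahnSeries ℝ K) : Prop := a = 0 ∨ 0 ≤ a.order

/-- `M ∈ GL_r(R)`: all entries of `M` lie in `R` and `M` has a two-sided inverse with
entries in `R`. -/
def InGLR {r : ℕ} (M : Matrix (Fin r) (Fin r) (HahnSeries ℝ K)) : Prop :=
  (∀ i j, inR (M i j)) ∧
    ∃ N : Matrix (Fin r) (Fin r) (HahnSeries ℝ K),
      (∀ i j, inR (N i j)) ∧ M * N = 1 ∧ N * M = 1

/-- The diagonal matrix `D_μ = diag(t^{μ_1}, …, t^{μ_r})`. -/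
def Dmat (K : Type*) [Field K] {r : ℕ} (μ : Fin r → ℝ) :
    Matrix (Fin r) (Fin r) (HahnSeries ℝ K) :=
  Matrix.diagonal fun i => HahnSeries.single (μ i) 1

/-- `D_ν̂ = diag(t^{ν_r}, …, t^{ν_1})`. -/
def DmatHat (K : Type*) [Field K] {r : ℕ} (ν : Fin r → ℝ) :
    Matrix (Fin r) (Fin r) (HahnSeries ℝ K) :=
  Dmat K fun i => ν i.rev

/-- `inv(M) = μ`: `μ` is weakly decreasing and `P M Q⁻¹ = D_μ` for some `P, Q ∈ GL_r(R)`. -/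
def IsInv {r : ℕ} (M : Matrix (Fin r) (Fin r) (HahnSeries ℝ K)) (μ : Fin r → ℝ) : Prop :=
  Antitone μ ∧ ∃ P Q : Matrix (Fin r) (Fin r) (HahnSeries ℝ K),
    InGLR P ∧ InGLR Q ∧ P * M * Q⁻¹ = Dmat K μ

/-- `Q` is `μ`-admissible: `Q ∈ GL_r(R)` and `D_μ Q D_μ⁻¹ ∈ GL_r(R)`. -/
def MuAdmissible {r : ℕ} (μ : Fin r → ℝ)
    (Q : Matrix (Fin r) (Fin r) (HahnSeries ℝ K)) : Prop :=
  InGLR Q ∧ InGLR (Dmat K μ * Q * (Dmat K μ)⁻¹)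

/-- `T` is `ν̂`-admissible: `T ∈ GL_r(R)` and `D_ν̂⁻¹ T D_ν̂ ∈ GL_r(R)`. -/
def NuHatAdmissible {r : ℕ} (ν : Fin r → ℝ)
    (T : Matrix (Fin r) (Fin r) (HahnSeries ℝ K)) : Prop :=
  InGLR T ∧ InGLR ((DmatHat K ν)⁻¹ * T * DmatHat K ν)

/-- The minor `W_{IJ}`: the determinant of the `k × k` submatrix of `W` on rows `I` and
columns `J`. -/
def minorDet {r k : ℕ} (W : Matrix (Fin r) (Fin r) (HahnSeries ℝ K))
    (I J : Fin k → Fin r) : HahnSeries ℝ K :=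
  (W.submatrix I J).det

/-- Pair equivalence: `(A, B) = (P M Q⁻¹, Q N T⁻¹)` for some `P, Q, T ∈ GL_r(R)`. -/
def PairEquiv {r : ℕ} (M N A B : Matrix (Fin r) (Fin r) (HahnSeries ℝ K)) : Prop :=
  ∃ P Q T : Matrix (Fin r) (Fin r) (HahnSeries ℝ K),
    InGLR P ∧ InGLR Q ∧ InGLR T ∧ A = P * M * Q⁻¹ ∧ B = Q * N * T⁻¹

/-- `N` is `μ`-generic: full rank, upper triangular, and for all index sets
`I ⊆ H ⊆ J` of equal length the minors `N_{IJ}, N_{HJ}, N_{IH}` are nonzero with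
`‖N_{IJ}‖ ≤ ‖N_{HJ}‖ ≤ ‖N_{IJ}‖ + |μ_I| − |μ_H|` and `‖N_{IJ}‖ ≤ ‖N_{IH}‖`. -/
def MuGeneric {r : ℕ} (μ : Fin r → ℝ)
    (N : Matrix (Fin r) (Fin r) (HahnSeries ℝ K)) : Prop :=
  N.det ≠ 0 ∧ (∀ i j : Fin r, j < i → N i j = 0) ∧
  ∀ (k : ℕ) (I H J : Fin k → Fin r), StrictMono I → StrictMono H → StrictMono J →
    (∀ s, I s ≤ H s) → (∀ s, H s ≤ J s) →
    minorDet N I J ≠ 0 ∧ minorDet N H J ≠ 0 ∧ minorDet N I H ≠ 0 ∧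
    (minorDet N I J).order ≤ (minorDet N H J).order ∧
    (minorDet N H J).order ≤ (minorDet N I J).order + (∑ s, μ (I s)) - ∑ s, μ (H s) ∧
    (minorDet N I J).order ≤ (minorDet N I H).order

/-- `L` is `μ`-`ν̂`-generic: `L ∈ GL_r(R)`, lower triangular, and for all index sets
`I ⊆ H ⊆ J` of equal length the relevant minors are nonzero with
`‖L_{IJ}‖ ≤ ‖L_{HJ}‖ ≤ ‖L_{IJ}‖ + |μ_I| − |μ_H|` and
`‖L_{IJ}‖ ≤ ‖L_{IH}‖ ≤ ‖L_{IJ}‖ + |ν̂_J| − |ν̂_H|`. -/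
def MuNuGeneric {r : ℕ} (μ ν : Fin r → ℝ)
    (L : Matrix (Fin r) (Fin r) (HahnSeries ℝ K)) : Prop :=
  InGLR L ∧ (∀ i j : Fin r, i < j → L i j = 0) ∧
  ∀ (k : ℕ) (I H J : Fin k → Fin r), StrictMono I → StrictMono H → StrictMono J →
    (∀ s, I s ≤ H s) → (∀ s, H s ≤ J s) →
    minorDet L I J ≠ 0 ∧ minorDet L H J ≠ 0 ∧ minorDet L I H ≠ 0 ∧
    (minorDet L I J).order ≤ (minorDet L H J).order ∧
    (minorDet L H J).order ≤ (minorDet L I J).order + (∑ s, μ (I s)) - (∑ s, μ (H s)) ∧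
    (minorDet L I J).order ≤ (minorDet L I H).order ∧
    (minorDet L I H).order ≤
      (minorDet L I J).order + (∑ s, ν ((J s).rev)) - ∑ s, ν ((H s).rev)

/-- The rightmost `k` columns `(r−k+1, …, r)` of an `r × r` matrix, as a map
`Fin k → Fin r`. -/
def lastCols (r k : ℕ) (h : k ≤ r) : Fin k → Fin r :=
  fun i => ⟨r - k + i.val, by have := i.isLt; omega⟩

/-- The set of (0-based) rows of an `r × r` matrix that remain after omitting the rows
with 1-based index in the interval `[p, q]`. -/
def keptRows (r p q : ℕ) : Finset (Fin r) :=
  (Finset.univ.filter fun x : Fin r => p ≤ x.val + 1 ∧ x.val + 1 ≤ q)ᶜ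

lemma keptRows_card_le (r p q : ℕ) : (keptRows r p q).card ≤ r := by
  simpa using (keptRows r p q).card_le_univ

/-- `‖((p)^∧, …, (q)^∧)‖` for the matrix `N`: the order of the minor of `N` on the rows
`{1, …, r} ∖ {p, …, q}` (1-based) and the rightmost columns; when `p > q` no row is
omitted and this is `‖det N‖`. -/
def hatOrd {r : ℕ} (N : Matrix (Fin r) (Fin r) (HahnSeries ℝ K)) (p q : ℕ) : ℝ :=
  (minorDet N (fun i => ((keptRows r p q).orderIsoOfFin rfl i).1)
    (lastCols r (keptRows r p q).card (keptRows_card_le r p q))).order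

/-- `k` is the right filling of a pair `(M, N)` with `inv(M) = μ`: there is a
`μ`-generic matrix `N*` with `(D_μ, N*)` pair-equivalent to `(M, N)` such that `k`
satisfies the determinantal formula
`k_{1j} + ⋯ + k_{ij} = ‖((j−i)^∧, …, (j−1)^∧)‖ − ‖((j−i+1)^∧, …, (j)^∧)‖`
(all indices written 1-based). -/
def RightFillingOf {r : ℕ} (μ : Fin r → ℝ)
    (M N : Matrix (Fin r) (Fin r) (HahnSeries ℝ K))
    (k : Fin r → Fin r → ℝ) : Prop :=
  ∃ Nstar : Matrix (Fin r) (Fin r) (HahnSeries ℝ K),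
    MuGeneric μ Nstar ∧ PairEquiv M N (Dmat K μ) Nstar ∧
    ∀ i j : Fin r, i ≤ j →
      ∑ s ∈ Finset.Iic i, k s j =
        hatOrd Nstar (j.val - i.val) j.val - hatOrd Nstar (j.val - i.val + 1) (j.val + 1)

/-- The left filling of `(M, N)` is the right filling of the transposed pair
`(Nᵀ, Mᵀ)`. -/
def LeftFillingOf {r : ℕ} (ν : Fin r → ℝ)
    (M N : Matrix (Fin r) (Fin r) (HahnSeries ℝ K))
    (m : Fin r → Fin r → ℝ) : Prop :=
  RightFillingOf ν Nᵀ Mᵀ m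

/-- `{k_ij : 1 ≤ i ≤ j ≤ r}` (indexed 0-based here) is an `L𝕉` filling of type
`(μ, ν; λ)`: the conditions (LR1)–(LR4). -/
def IsLRFilling {r : ℕ} (μ ν lam : Fin r → ℝ) (k : Fin r → Fin r → ℝ) : Prop :=
  (∀ j : Fin r, μ j + ∑ s ∈ Finset.Iic j, k s j = lam j) ∧
  (∀ i : Fin r, ∑ s ∈ Finset.Ici i, k i s = ν i) ∧
  (∀ i j : Fin r, i < j → 0 ≤ k i j) ∧
  (∀ (i j : ℕ) (hi : i < r) (hj : j < r), i ≤ j → 1 ≤ j →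
    μ ⟨j, hj⟩ + ∑ s ∈ Finset.Iic (⟨i, hi⟩ : Fin r), k s ⟨j, hj⟩ ≤
      μ ⟨j - 1, by omega⟩ + ∑ s ∈ Finset.Iio (⟨i, hi⟩ : Fin r), k s ⟨j - 1, by omega⟩) ∧
  (∀ (i j : ℕ) (hij : i ≤ j) (hj : j + 1 < r),
    ∑ s ∈ Finset.Icc (⟨i + 1, by omega⟩ : Fin r) ⟨j + 1, hj⟩, k ⟨i + 1, by omega⟩ s ≤
      ∑ s ∈ Finset.Icc (⟨i, by omega⟩ : Fin r) ⟨j, by omega⟩, k ⟨i, by omega⟩ s)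


section RightMinors

variable {F : Type*} [Field F]

/-! ### The additive valuation on the Hahn series field -/

lemma inR_iff_addVal_nonneg (a : HahnSeries ℝ F) : inR a ↔ 0 ≤ addVal ℝ F a := by
  rcases eq_or_ne a 0 with rfl | ha
  · simp [inR]
  · rw [addVal_apply_of_ne ha, inR, ← WithTop.coe_zero, WithTop.coe_le_coe]
    simp [ha]

lemma inR_mul {a b : HahnSeries ℝ F} (ha : inR a) (hb : inR b) : inR (a * b) := by
  rw [inR_iff_addVal_nonneg] at *
  rw [AddValuation.map_mul]
  exact add_nonneg ha hb

lemma inR_sum {ι : Type*} (s : Finset ι) (f : ι → HahnSeries ℝ F) (h : ∀ i ∈ s, inR (f i)) :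
    inR (∑ i ∈ s, f i) := by
  simp only [inR_iff_addVal_nonneg] at *
  exact (addVal ℝ F).map_le_sum h

lemma sum_le_addVal_prod {ι : Type*} (s : Finset ι) (f : ι → HahnSeries ℝ F) (c : ι → ℝ)
    (h : ∀ i ∈ s, (c i : WithTop ℝ) ≤ addVal ℝ F (f i)) :
    ((∑ i ∈ s, c i : ℝ) : WithTop ℝ) ≤ addVal ℝ F (∏ i ∈ s, f i) := by
  classical
  induction s using Finset.induction_on with
  | empty => simp
  | insert a s ha ih =>
    rw [Finset.sum_insert ha, Finset.prod_insert ha, AddValuation.map_mul, WithTop.coe_add]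
    exact add_le_add (h a (Finset.mem_insert_self a s))
      (ih fun i hi => h i (Finset.mem_insert_of_mem hi))

/-! ### The group `GL_r(R)` and pair equivalence -/

section GLR

variable {r : ℕ} {A B M N M' N' : Matrix (Fin r) (Fin r) (HahnSeries ℝ F)}

lemma inR_matrix_mul (hA : ∀ i j, inR (A i j)) (hB : ∀ i j, inR (B i j)) (i j : Fin r) :
    inR ((A * B) i j) := by
  rw [Matrix.mul_apply]
  exact inR_sum _ _ fun l _ => inR_mul (hA i l) (hB l j)

lemma InGLR.mul (hA : InGLR A) (hB : InGLR B) : InGLR (A * B) := by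
  obtain ⟨hA, A', hA', h1, h2⟩ := hA
  obtain ⟨hB, B', hB', h3, h4⟩ := hB
  refine ⟨inR_matrix_mul hA hB, B' * A', inR_matrix_mul hB' hA', ?_, ?_⟩
  · rw [Matrix.mul_assoc, ← Matrix.mul_assoc B, h3, Matrix.one_mul, h1]
  · rw [Matrix.mul_assoc, ← Matrix.mul_assoc A', h2, Matrix.one_mul, h4]

lemma InGLR.isUnit_det (hA : InGLR A) : IsUnit A.det := by
  obtain ⟨-, A', -, h, -⟩ := hA
  exact (Matrix.isUnit_iff_isUnit_det A).1 (IsUnit.of_mul_eq_one A' h)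

lemma InGLR.inv (hA : InGLR A) : InGLR A⁻¹ := by
  obtain ⟨hA, A', hA', h1, h2⟩ := hA
  rw [Matrix.inv_eq_right_inv h1]
  exact ⟨hA', A, hA, h2, h1⟩

lemma PairEquiv.symm (h : PairEquiv M N A B) : PairEquiv A B M N := by
  obtain ⟨P, Q, T, hP, hQ, hT, rfl, rfl⟩ := h
  refine ⟨P⁻¹, Q⁻¹, T⁻¹, hP.inv, hQ.inv, hT.inv, ?_, ?_⟩
  · rw [Matrix.nonsing_inv_nonsing_inv _ hQ.isUnit_det, Matrix.mul_assoc P,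
      Matrix.nonsing_inv_mul_cancel_left _ _ hP.isUnit_det,
      Matrix.nonsing_inv_mul_cancel_right _ _ hQ.isUnit_det]
  · rw [Matrix.nonsing_inv_nonsing_inv _ hT.isUnit_det, Matrix.mul_assoc Q,
      Matrix.nonsing_inv_mul_cancel_left _ _ hQ.isUnit_det,
      Matrix.nonsing_inv_mul_cancel_right _ _ hT.isUnit_det]

lemma PairEquiv.trans (h : PairEquiv M N M' N') (h' : PairEquiv M' N' A B) :
    PairEquiv M N A B := by
  obtain ⟨P, Q, T, hP, hQ, hT, rfl, rfl⟩ := h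
  obtain ⟨P', Q', T', hP', hQ', hT', rfl, rfl⟩ := h'
  exact ⟨P' * P, Q' * Q, T' * T, hP'.mul hP, hQ'.mul hQ, hT'.mul hT,
    by simp only [Matrix.mul_inv_rev, Matrix.mul_assoc],
    by simp only [Matrix.mul_inv_rev, Matrix.mul_assoc]⟩

end GLR

/-- If `D_μ = P D_μ Q⁻¹` with `P, Q ∈ GL_r(R)`, then the entry `Q_{ih}` has order at least
`max 0 (μ_h − μ_i)`. -/
lemma max_le_addVal_of_Dmat_eq {r : ℕ} {μ : Fin r → ℝ}
    {P Q : Matrix (Fin r) (Fin r) (HahnSeries ℝ F)} (hP : InGLR P) (hQ : InGLR Q)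
    (h : Dmat F μ = P * Dmat F μ * Q⁻¹) (i l : Fin r) :
    ((max 0 (μ l - μ i) : ℝ) : WithTop ℝ) ≤ addVal ℝ F (Q i l) := by
  have hQil := (inR_iff_addVal_nonneg _).1 (hQ.1 i l)
  have hPil := (inR_iff_addVal_nonneg _).1 (hP.1 i l)
  have hcomm : Dmat F μ * Q = P * Dmat F μ := by
    nth_rewrite 1 [h]
    rw [Matrix.nonsing_inv_mul_cancel_right _ _ hQ.isUnit_det]
  have hent := congrArg (addVal ℝ F) (congrFun (congrFun hcomm i) l)
  rw [Dmat, Matrix.diagonal_mul, Matrix.mul_diagonal, AddValuation.map_mul,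
    AddValuation.map_mul, addVal_apply (x := single _ _), addVal_apply (x := single _ _),
    orderTop_single one_ne_zero, orderTop_single one_ne_zero] at hent
  have hle : (μ l : WithTop ℝ) ≤ μ i + addVal ℝ F (Q i l) := by
    rw [hent]
    exact le_add_of_nonneg_left hPil
  generalize addVal ℝ F (Q i l) = v at *
  induction v using WithTop.recTopCoe with
  | top => exact le_top
  | coe v =>
    norm_cast at *
    exact max_le hQil (by linarith)

/-! ### Minors of products -/

section Minors

variable {r k : ℕ}

lemma minorDet_mul_eq_sum_rows (A B : Matrix (Fin r) (Fin r) (HahnSeries ℝ F))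
    (I J : Fin k → Fin r) :
    minorDet (A * B) I J = ∑ f : Fin k → Fin r, (∏ s, A (I s) (f s)) * minorDet B f J := by
  have h : (A * B).submatrix I J = fun s => ∑ l, A (I s) l • fun t => B l (J t) := by
    ext s t
    simp [Matrix.mul_apply, Finset.sum_apply]
  have h' : minorDet (A * B) I J = (Matrix.detRowAlternating (R := HahnSeries ℝ F)
      (n := Fin k)).toMultilinearMap fun s => ∑ l, A (I s) l • fun t => B l (J t) := by
    rw [minorDet, h]
    rfl
  rw [h', MultilinearMap.map_sum]
  refine Finset.sum_congr rfl fun f _ => ?_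
  rw [MultilinearMap.map_smul_univ]
  rfl

lemma minorDet_mul_eq_sum_cols (A B : Matrix (Fin r) (Fin r) (HahnSeries ℝ F))
    (I J : Fin k → Fin r) :
    minorDet (A * B) I J = ∑ g : Fin k → Fin r, (∏ s, B (g s) (J s)) * minorDet A I g := by
  have htr (W : Matrix (Fin r) (Fin r) (HahnSeries ℝ F)) (I J : Fin k → Fin r) :
      minorDet W I J = minorDet Wᵀ J I := by
    rw [minorDet, minorDet, ← Matrix.det_transpose, Matrix.transpose_submatrix]
  rw [htr, Matrix.transpose_mul, minorDet_mul_eq_sum_rows]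
  exact Finset.sum_congr rfl fun g _ => by rw [htr A I g]; rfl

lemma minorDet_eq_zero_of_not_injective_rows (W : Matrix (Fin r) (Fin r) (HahnSeries ℝ F))
    {I : Fin k → Fin r} (J : Fin k → Fin r) (hI : ¬ Function.Injective I) :
    minorDet W I J = 0 := by
  obtain ⟨s, t, hst, hne⟩ := Function.not_injective_iff.1 hI
  exact Matrix.det_zero_of_row_eq hne (by ext; simp [hst])

lemma minorDet_eq_zero_of_not_injective_cols (W : Matrix (Fin r) (Fin r) (HahnSeries ℝ F))
    (I : Fin k → Fin r) {J : Fin k → Fin r} (hJ : ¬ Function.Injective J) :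
    minorDet W I J = 0 := by
  obtain ⟨s, t, hst, hne⟩ := Function.not_injective_iff.1 hJ
  exact Matrix.det_zero_of_column_eq hne fun i => by simp [hst]

lemma addVal_sign_mul (σ : Equiv.Perm (Fin k)) (a : HahnSeries ℝ F) :
    addVal ℝ F (((Equiv.Perm.sign σ : ℤ) : HahnSeries ℝ F) * a) = addVal ℝ F a := by
  rcases Int.units_eq_one_or (Equiv.Perm.sign σ) with h | h <;> simp [h]

lemma addVal_minorDet_perm_rows (W : Matrix (Fin r) (Fin r) (HahnSeries ℝ F))
    (I J : Fin k → Fin r) (σ : Equiv.Perm (Fin k)) :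
    addVal ℝ F (minorDet W (I ∘ σ) J) = addVal ℝ F (minorDet W I J) := by
  rw [← addVal_sign_mul σ (minorDet W I J), minorDet, minorDet, ← Matrix.det_permute]
  rfl

lemma addVal_minorDet_perm_cols (W : Matrix (Fin r) (Fin r) (HahnSeries ℝ F))
    (I J : Fin k → Fin r) (σ : Equiv.Perm (Fin k)) :
    addVal ℝ F (minorDet W I (J ∘ σ)) = addVal ℝ F (minorDet W I J) := by
  rw [← addVal_sign_mul σ (minorDet W I J), minorDet, minorDet, ← Matrix.det_permute']
  rfl

lemma strictMono_comp_sort {f : Fin k → Fin r} (hf : Function.Injective f) :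
    StrictMono (f ∘ Tuple.sort f) :=
  (Tuple.monotone_sort f).strictMono_of_injective (hf.comp (Tuple.sort f).injective)

lemma minorDet_eq_zero_of_upperTriangular {W : Matrix (Fin r) (Fin r) (HahnSeries ℝ F)}
    (hW : ∀ i j : Fin r, j < i → W i j = 0) {I J : Fin k → Fin r} (hI : Monotone I)
    (hJ : Monotone J) (hIJ : ¬ ∀ s, I s ≤ J s) : minorDet W I J = 0 := by
  push Not at hIJ
  obtain ⟨s, hs⟩ := hIJ
  rw [minorDet, Matrix.det_apply]
  refine Finset.sum_eq_zero fun σ _ => ?_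
  obtain ⟨u, hus, hsu⟩ : ∃ u, u ≤ s ∧ s ≤ σ u := by
    by_contra! hlt
    have hcard := Finset.card_le_card_of_injOn (s := Finset.Iic s) (t := Finset.Iio s) σ
      (fun u hu => by simpa using hlt u (by simpa using hu)) σ.injective.injOn
    simp at hcard
  rw [Finset.prod_eq_zero (Finset.mem_univ u), smul_zero]
  exact hW _ _ ((hJ hus).trans_lt (hs.trans_le (hI hsu)))

lemma lastCols_strictMono (h : k ≤ r) : StrictMono (lastCols r k h) := by
  intro i j hij
  simp only [lastCols, Fin.lt_def] at *
  omega

lemma le_lastCols {H : Fin k → Fin r} (hH : StrictMono H) (h : k ≤ r) (s : Fin k) :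
    H s ≤ lastCols r k h s := by
  have hcard := Finset.card_le_card_of_injOn (s := Finset.Ici s) (t := Finset.Ici (H s)) H
    (fun u hu => by simpa using hH.monotone (by simpa using hu)) hH.injective.injOn
  simp only [Fin.card_Ici] at hcard
  simp only [lastCols, Fin.le_def]
  omega

end Minors

/-- Sorting `f` does not increase the total excess of `μ ∘ f` over `μ ∘ I` when `I` is
monotone and `μ` is antitone. -/
lemma sum_max_sub_comp_sort_le {r k : ℕ} {μ : Fin r → ℝ} (hμ : Antitone μ)
    {I : Fin k → Fin r} (hI : Monotone I) (f : Fin k → Fin r) :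
    ∑ s, max 0 (μ ((f ∘ Tuple.sort f) s) - μ (I s)) ≤ ∑ s, max 0 (μ (f s) - μ (I s)) := by
  refine Tuple.bubble_sort_induction
    (P := fun g => ∑ s, max 0 (μ (g s) - μ (I s)) ≤ ∑ s, max 0 (μ (f s) - μ (I s)))
    le_rfl fun g i j hij hg hle => le_trans ?_ hle
  rw [← Finset.add_sum_erase _ _ (Finset.mem_univ i),
    ← Finset.add_sum_erase _ _ (Finset.mem_erase.2 ⟨hij.ne', Finset.mem_univ j⟩),
    ← Finset.add_sum_erase _ (fun s => max 0 (μ (g s) - μ (I s))) (Finset.mem_univ i),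
    ← Finset.add_sum_erase _ (fun s => max 0 (μ (g s) - μ (I s)))
      (Finset.mem_erase.2 ⟨hij.ne', Finset.mem_univ j⟩)]
  have hrest : ∀ s ∈ (Finset.univ.erase i).erase j,
      max 0 (μ ((g ∘ Equiv.swap i j) s) - μ (I s)) = max 0 (μ (g s) - μ (I s)) := by
    intro s hs
    simp only [Finset.mem_erase] at hs
    rw [Function.comp_apply, Equiv.swap_apply_of_ne_of_ne hs.2.1 hs.1]
  rw [Finset.sum_congr rfl hrest]
  simp only [Function.comp_apply, Equiv.swap_apply_left, Equiv.swap_apply_right]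
  have h1 := hμ hg.le
  have h2 := hμ (hI hij.le)
  have h3 : max 0 (μ (g j) - μ (I i)) + max 0 (μ (g i) - μ (I j)) ≤
      max 0 (μ (g i) - μ (I i)) + max 0 (μ (g j) - μ (I j)) := by
    grind
  linarith

/-! ### Minors of a generic matrix on the rightmost columns -/

section Generic

variable {r k : ℕ} {μ : Fin r → ℝ} {N : Matrix (Fin r) (Fin r) (HahnSeries ℝ F)}

lemma MuGeneric.addVal_lastCols_le (hN : MuGeneric μ N) (hkr : k ≤ r) {G : Fin k → Fin r}
    (hG : StrictMono G) (f : Fin k → Fin r) :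
    addVal ℝ F (minorDet N G (lastCols r k hkr)) ≤ addVal ℝ F (minorDet N G f) := by
  by_cases hf : Function.Injective f
  · have hH := strictMono_comp_sort hf
    rw [← addVal_minorDet_perm_cols N G f (Tuple.sort f)]
    by_cases hGH : ∀ s, G s ≤ (f ∘ Tuple.sort f) s
    · obtain ⟨h1, -, h2, -, -, h3⟩ := hN.2.2 k G _ _ hG hH (lastCols_strictMono hkr) hGH
        (le_lastCols hH hkr)
      rw [addVal_apply_of_ne h1, addVal_apply_of_ne h2]
      exact WithTop.coe_le_coe.2 h3
    · simp [minorDet_eq_zero_of_upperTriangular hN.2.1 hG.monotone hH.monotone hGH]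
  · simp [minorDet_eq_zero_of_not_injective_cols N G hf]

lemma MuGeneric.addVal_lastCols_le_add (hμ : Antitone μ) (hN : MuGeneric μ N) (hkr : k ≤ r)
    {I H : Fin k → Fin r} (hI : StrictMono I) (hH : StrictMono H) :
    addVal ℝ F (minorDet N I (lastCols r k hkr)) ≤
      ((∑ s, max 0 (μ (H s) - μ (I s)) : ℝ) : WithTop ℝ) +
        addVal ℝ F (minorDet N H (lastCols r k hkr)) := by
  have hm : StrictMono fun s => min (I s) (H s) := fun s t hst => by
    simpa using (⟨Or.inl (hI hst), Or.inr (hH hst)⟩ : (_ ∨ _) ∧ (_ ∨ _))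
  have hL := lastCols_strictMono hkr
  obtain ⟨-, h1, -, -, h2, -⟩ := hN.2.2 k _ I _ hm hI hL (fun s => min_le_left _ _)
    (le_lastCols hI hkr)
  obtain ⟨-, h3, -, h4, -, -⟩ := hN.2.2 k _ H _ hm hH hL (fun s => min_le_right _ _)
    (le_lastCols hH hkr)
  have hsum : ∑ s, max 0 (μ (H s) - μ (I s)) =
      ∑ s, μ (min (I s) (H s)) - ∑ s, μ (I s) := by
    rw [← Finset.sum_sub_distrib]
    refine Finset.sum_congr rfl fun s _ => ?_
    rw [hμ.map_min, ← max_sub_sub_right, sub_self]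
  rw [addVal_apply_of_ne h1, addVal_apply_of_ne h3, ← WithTop.coe_add, WithTop.coe_le_coe, hsum]
  linarith

lemma MuGeneric.addVal_le_of_mul_mul (hμ : Antitone μ) (hN : MuGeneric μ N) (hkr : k ≤ r)
    {Q T : Matrix (Fin r) (Fin r) (HahnSeries ℝ F)}
    (hQ : ∀ i l, ((max 0 (μ l - μ i) : ℝ) : WithTop ℝ) ≤ addVal ℝ F (Q i l))
    (hT : ∀ i l, inR (T i l)) {I : Fin k → Fin r} (hI : StrictMono I) (J : Fin k → Fin r) :
    addVal ℝ F (minorDet N I (lastCols r k hkr)) ≤ addVal ℝ F (minorDet (Q * N * T) I J) := by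
  rw [minorDet_mul_eq_sum_cols]
  refine (addVal ℝ F).map_le_sum fun g _ => ?_
  rw [AddValuation.map_mul]
  have hTg : 0 ≤ addVal ℝ F (∏ s, T (g s) (J s)) := by
    simpa using sum_le_addVal_prod Finset.univ (fun s => T (g s) (J s)) (fun _ => 0)
      fun s _ => by simpa using (inR_iff_addVal_nonneg _).1 (hT (g s) (J s))
  refine le_add_of_nonneg_of_le hTg ?_
  rw [minorDet_mul_eq_sum_rows]
  refine (addVal ℝ F).map_le_sum fun f _ => ?_
  rw [AddValuation.map_mul]
  by_cases hf : Function.Injective f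
  · have hH := strictMono_comp_sort hf
    rw [← addVal_minorDet_perm_rows N f g (Tuple.sort f)]
    refine (hN.addVal_lastCols_le_add hμ hkr hI hH).trans (add_le_add ?_
      (hN.addVal_lastCols_le hkr hH g))
    exact (WithTop.coe_le_coe.2 (sum_max_sub_comp_sort_le hμ hI.monotone f)).trans
      (sum_le_addVal_prod Finset.univ _ _ fun s _ => hQ (I s) (f s))
  · simp [minorDet_eq_zero_of_not_injective_rows N g hf]

lemma MuGeneric.addVal_le_of_pairEquiv (hμ : Antitone μ) (hN : MuGeneric μ N)
    {N' : Matrix (Fin r) (Fin r) (HahnSeries ℝ F)}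
    (h : PairEquiv (Dmat F μ) N (Dmat F μ) N') (hkr : k ≤ r) {I : Fin k → Fin r}
    (hI : StrictMono I) :
    addVal ℝ F (minorDet N I (lastCols r k hkr)) ≤
      addVal ℝ F (minorDet N' I (lastCols r k hkr)) := by
  obtain ⟨P, Q, T, hP, hQ, hT, hD, rfl⟩ := h
  exact hN.addVal_le_of_mul_mul hμ hkr (max_le_addVal_of_Dmat_eq hP hQ hD) hT.inv.1 hI _

lemma MuGeneric.hatOrd_eq_of_pairEquiv (hμ : Antitone μ) (hN : MuGeneric μ N)
    {N' : Matrix (Fin r) (Fin r) (HahnSeries ℝ F)} (hN' : MuGeneric μ N')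
    (h : PairEquiv (Dmat F μ) N (Dmat F μ) N') (p q : ℕ) : hatOrd N p q = hatOrd N' p q := by
  have hkr := keptRows_card_le r p q
  have hI : StrictMono fun i => ((keptRows r p q).orderIsoOfFin rfl i).1 := fun i j hij =>
    ((keptRows r p q).orderIsoOfFin rfl).strictMono hij
  have hL := lastCols_strictMono hkr
  have heq := (hN.addVal_le_of_pairEquiv hμ h hkr hI).antisymm
    (hN'.addVal_le_of_pairEquiv hμ h.symm hkr hI)
  have h1 := (hN.2.2 _ _ _ _ hI hI hL (fun _ => le_rfl) (le_lastCols hI hkr)).1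
  have h2 := (hN'.2.2 _ _ _ _ hI hI hL (fun _ => le_rfl) (le_lastCols hI hkr)).1
  rw [addVal_apply_of_ne h1, addVal_apply_of_ne h2] at heq
  exact WithTop.coe_injective heq

end Generic

end RightMinors

/-- (Uniqueness) Pair-equivalent full-rank pairs yield identical right
`L𝕉` fillings, independently of the chosen `μ`-generic realizations. -/
theorem right_filling_unique {r : ℕ} (μ : Fin r → ℝ)
    (M N M' N' : Matrix (Fin r) (Fin r) (HahnSeries ℝ K))
    (hM : M.det ≠ 0) (hN : N.det ≠ 0) (hM' : M'.det ≠ 0) (hN' : N'.det ≠ 0)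
    (hpe : PairEquiv M N M' N')
    (hinvM : IsInv M μ) (hinvM' : IsInv M' μ)
    (k k' : Fin r → Fin r → ℝ)
    (hk : RightFillingOf μ M N k) (hk' : RightFillingOf μ M' N' k') :
    ∀ i j : Fin r, i ≤ j → k i j = k' i j := by
  obtain ⟨N₁, hN₁, hpe₁, hk₁⟩ := hk
  obtain ⟨N₂, hN₂, hpe₂, hk₂⟩ := hk'
  have hhat := hN₁.hatOrd_eq_of_pairEquiv hinvM.1 hN₂ (hpe₁.symm.trans (hpe.trans hpe₂))
  intro i j
  induction i using WellFoundedLT.induction with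
  | ind i ih =>
    intro hij
    have hsum : ∑ s ∈ Finset.Iic i, k s j = ∑ s ∈ Finset.Iic i, k' s j := by
      rw [hk₁ i j hij, hk₂ i j hij, hhat, hhat]
    rw [← Finset.Iio_insert, Finset.sum_insert (by simp), Finset.sum_insert (by simp),
      Finset.sum_congr rfl fun s hs =>
        ih s (Finset.mem_Iio.1 hs) ((Finset.mem_Iio.1 hs).le.trans hij)] at hsum
    exact add_right_cancel hsum

end
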